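/- arXiv:math/0512414 — 2 statements merged into one kernel-verified Lean document; each statement's English description precedes it below -/
import Mathlib

section
/- Let φ : ℝ^d → ℝ be a Schwartz function, let 𝓕φ denote its Fourier transform (so 𝓕φ(0) = ∫_{ℝ^d} φ), let ψ : [0,1] → ℝ be continuous and χ(u) = ∫_u^1 ψ(s) ds. Then lim_{T→∞} T^{d/α − 1} ∫_{ℝ^d} (1/‖z‖^α) · |𝓕φ(z)|² · ( ∫₀¹ e^{-Tu‖z‖^α} χ(u) du )² dz = (2 π^{d/2} Γ(d/α − 1) / (α Γ(d/2))) · ( ∫_{ℝ^d} φ )² · ∫₀¹∫₀¹ (u₁+u₂)^{1 − d/α} χ(u₁) χ(u₂) du₁ du₂. -/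
open MeasureTheory Real Filter
open scoped FourierTransform

theorem integral_one_div_norm_rpow_mul_exp_neg {d : ℕ} (hd : 0 < d) {α : ℝ} (hα : 0 < α)
    (h1 : α < d) {s : ℝ} (hs : 0 < s) :
    Integrable (fun z : EuclideanSpace ℝ (Fin d) => 1 / ‖z‖ ^ α * exp (-(s * ‖z‖ ^ α))) ∧
      ∫ z : EuclideanSpace ℝ (Fin d), 1 / ‖z‖ ^ α * exp (-(s * ‖z‖ ^ α)) =
        2 * π ^ ((d : ℝ) / 2) * Gamma ((d : ℝ) / α - 1) / (α * Gamma ((d : ℝ) / 2)) *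
          s ^ (1 - (d : ℝ) / α) := by
  have : Nonempty (Fin d) := ⟨⟨0, hd⟩⟩
  have hd' : (0 : ℝ) < d := Nat.cast_pos.2 hd
  have hq : (-1 : ℝ) < (d : ℝ) - 1 - α := by linarith
  have hcongr : Set.EqOn
      (fun y : ℝ => y ^ (Module.finrank ℝ (EuclideanSpace ℝ (Fin d)) - 1) •
        (1 / y ^ α * exp (-(s * y ^ α))))
      (fun y => y ^ ((d : ℝ) - 1 - α) * exp (-s * y ^ α)) (Set.Ioi 0) := by
    intro y (hy : 0 < y)
    simp only [finrank_euclideanSpace_fin, smul_eq_mul]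
    rw [rpow_sub hy, ← rpow_natCast, Nat.cast_sub hd, Nat.cast_one, neg_mul]
    ring
  constructor
  · rw [integrable_fun_norm_addHaar volume (f := fun y : ℝ => 1 / y ^ α * exp (-(s * y ^ α))),
      integrableOn_congr_fun hcongr measurableSet_Ioi]
    exact integrableOn_rpow_mul_exp_neg_mul_rpow hq hα hs
  · rw [integral_fun_norm_addHaar volume (fun y : ℝ => 1 / y ^ α * exp (-(s * y ^ α))),
      setIntegral_congr_fun measurableSet_Ioi hcongr,
      integral_rpow_mul_exp_neg_mul_rpow hα hq hs, measureReal_def,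
      EuclideanSpace.volume_ball, finrank_euclideanSpace_fin, Fintype.card_fin]
    have hΓ : Gamma ((d : ℝ) / 2 + 1) = (d : ℝ) / 2 * Gamma ((d : ℝ) / 2) :=
      Gamma_add_one (by positivity)
    have hπ : √π ^ d = π ^ ((d : ℝ) / 2) := by
      rw [sqrt_eq_rpow, ← rpow_natCast, ← rpow_mul pi_pos.le]
      ring_nf
    have hexp : ((d : ℝ) - 1 - α + 1) / α = (d : ℝ) / α - 1 := by field_simp; ring
    have hexp' : -((d : ℝ) - 1 - α + 1) / α = 1 - (d : ℝ) / α := by field_simp; ring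
    have hΓpos : 0 < Gamma ((d : ℝ) / 2) := Gamma_pos_of_pos (by positivity)
    rw [hΓ, hπ, hexp, hexp', ENNReal.ofReal_one, one_pow, one_mul,
      ENNReal.toReal_ofReal (by positivity), nsmul_eq_mul, smul_eq_mul]
    field_simp

theorem integrable_add_rpow_prod {β : ℝ} (hβ : β ≤ 0) (hβ' : -1 < β) :
    Integrable (fun p : ℝ × ℝ => (p.1 + p.2) ^ β)
      ((volume.restrict (Set.Ioc 0 1)).prod (volume.restrict (Set.Ioc 0 1))) := by
  have hdom : Integrable (fun p : ℝ × ℝ => p.1 ^ β)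
      ((volume.restrict (Set.Ioc 0 1)).prod (volume.restrict (Set.Ioc 0 1))) :=
    Integrable.comp_fst (f := fun u : ℝ => u ^ β)
      ((intervalIntegrable_iff_integrableOn_Ioc_of_le zero_le_one).1
        (intervalIntegral.intervalIntegrable_rpow' hβ')) _
  refine hdom.mono'
    (by fun_prop : Measurable fun p : ℝ × ℝ => (p.1 + p.2) ^ β).aestronglyMeasurable ?_
  rw [Measure.prod_restrict]
  refine (ae_restrict_mem (measurableSet_Ioc.prod measurableSet_Ioc)).mono fun p hp => ?_
  have h₁ : 0 < p.1 := hp.1.1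
  have h₂ : 0 < p.2 := hp.2.1
  rw [norm_of_nonneg (by positivity)]
  exact rpow_le_rpow_of_nonpos h₁ (by linarith) hβ

theorem integrable_one_div_norm_rpow_mul_exp_neg_prod {d : ℕ} (hd : 0 < d) {α : ℝ} (hα : 0 < α)
    (h1 : α < d) (h2 : (d : ℝ) < 2 * α) :
    Integrable (fun q : EuclideanSpace ℝ (Fin d) × ℝ × ℝ =>
        1 / ‖q.1‖ ^ α * exp (-((q.2.1 + q.2.2) * ‖q.1‖ ^ α)))
      (volume.prod ((volume.restrict (Set.Ioc 0 1)).prod (volume.restrict (Set.Ioc 0 1)))) := by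
  have hβ : 1 - (d : ℝ) / α ≤ 0 := by
    rw [sub_nonpos, le_div_iff₀ hα]; linarith
  have hβ' : -1 < 1 - (d : ℝ) / α := by
    have : (d : ℝ) / α < 2 := by rwa [div_lt_iff₀ hα]
    linarith
  have hpos : ∀ᵐ p : ℝ × ℝ ∂((volume.restrict (Set.Ioc 0 1)).prod
      (volume.restrict (Set.Ioc 0 1))), 0 < p.1 + p.2 := by
    rw [Measure.prod_restrict]
    exact (ae_restrict_mem (measurableSet_Ioc.prod measurableSet_Ioc)).mono
      fun p hp => add_pos hp.1.1 hp.2.1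
  rw [integrable_prod_iff' (by fun_prop)]
  refine ⟨hpos.mono fun p hp => (integral_one_div_norm_rpow_mul_exp_neg hd hα h1 hp).1, ?_⟩
  refine ((integrable_add_rpow_prod hβ hβ').const_mul (2 * π ^ ((d : ℝ) / 2) *
    Gamma ((d : ℝ) / α - 1) / (α * Gamma ((d : ℝ) / 2)))).congr (hpos.mono fun p hp => ?_)
  refine (integral_one_div_norm_rpow_mul_exp_neg hd hα h1 hp).2.symm.trans ?_
  refine integral_congr_ae (.of_forall fun z => ?_)
  exact (norm_of_nonneg (by positivity)).symm

theorem integral_one_div_norm_rpow_mul_sq_integral {d : ℕ} (hd : 0 < d) {α : ℝ} (hα : 0 < α)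
    (h1 : α < d) (h2 : (d : ℝ) < 2 * α) {χ : ℝ → ℝ} {M : ℝ}
    (hχ : AEStronglyMeasurable χ (volume.restrict (Set.Ioc 0 1)))
    (hM : ∀ u ∈ Set.Ioc (0 : ℝ) 1, ‖χ u‖ ≤ M) :
    Integrable (fun z : EuclideanSpace ℝ (Fin d) =>
        1 / ‖z‖ ^ α * (∫ u in (0 : ℝ)..1, exp (-(u * ‖z‖ ^ α)) * χ u) ^ 2) ∧
      ∫ z : EuclideanSpace ℝ (Fin d),
          1 / ‖z‖ ^ α * (∫ u in (0 : ℝ)..1, exp (-(u * ‖z‖ ^ α)) * χ u) ^ 2 =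
        2 * π ^ ((d : ℝ) / 2) * Gamma ((d : ℝ) / α - 1) / (α * Gamma ((d : ℝ) / 2)) *
          ∫ u₁ in (0 : ℝ)..1, ∫ u₂ in (0 : ℝ)..1,
            (u₁ + u₂) ^ (1 - (d : ℝ) / α) * χ u₁ * χ u₂ := by
  set μ : Measure ℝ := volume.restrict (Set.Ioc 0 1) with hμ
  have hmem : ∀ᵐ p : ℝ × ℝ ∂(μ.prod μ), p ∈ Set.Ioc (0 : ℝ) 1 ×ˢ Set.Ioc (0 : ℝ) 1 := by
    rw [hμ, Measure.prod_restrict]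
    exact ae_restrict_mem (measurableSet_Ioc.prod measurableSet_Ioc)
  have hχχ : AEStronglyMeasurable (fun p : ℝ × ℝ => χ p.1 * χ p.2) (μ.prod μ) :=
    hχ.comp_fst.mul hχ.comp_snd
  have hχχ_le : ∀ᵐ p : ℝ × ℝ ∂(μ.prod μ), ‖χ p.1 * χ p.2‖ ≤ M * M :=
    hmem.mono fun p hp => by
      rw [norm_mul]
      exact mul_le_mul (hM _ hp.1) (hM _ hp.2) (norm_nonneg _)
        ((norm_nonneg _).trans (hM _ hp.1))
  have hK : Integrable (fun q : EuclideanSpace ℝ (Fin d) × ℝ × ℝ =>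
      1 / ‖q.1‖ ^ α * exp (-((q.2.1 + q.2.2) * ‖q.1‖ ^ α)) * (χ q.2.1 * χ q.2.2))
      (volume.prod (μ.prod μ)) :=
    (integrable_one_div_norm_rpow_mul_exp_neg_prod hd hα h1 h2).mul_bdd (c := M * M)
      hχχ.comp_snd (Measure.quasiMeasurePreserving_snd.ae hχχ_le)
  have hsq : ∀ z : EuclideanSpace ℝ (Fin d),
      ∫ p : ℝ × ℝ, 1 / ‖z‖ ^ α * exp (-((p.1 + p.2) * ‖z‖ ^ α)) * (χ p.1 * χ p.2) ∂(μ.prod μ) =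
        1 / ‖z‖ ^ α * (∫ u in (0 : ℝ)..1, exp (-(u * ‖z‖ ^ α)) * χ u) ^ 2 := by
    intro z
    rw [intervalIntegral.integral_of_le zero_le_one, sq, ← hμ,
      ← integral_prod_mul (μ := μ) (ν := μ) (fun u => exp (-(u * ‖z‖ ^ α)) * χ u)
        (fun u => exp (-(u * ‖z‖ ^ α)) * χ u), ← integral_const_mul]
    congr 1 with p
    rw [add_mul, neg_add, exp_add]
    ring
  have hβ : 1 - (d : ℝ) / α ≤ 0 := by
    rw [sub_nonpos, le_div_iff₀ hα]; linarith
  have hβ' : -1 < 1 - (d : ℝ) / α := by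
    have : (d : ℝ) / α < 2 := by rwa [div_lt_iff₀ hα]
    linarith
  have hprod : Integrable
      (fun p : ℝ × ℝ => (p.1 + p.2) ^ (1 - (d : ℝ) / α) * χ p.1 * χ p.2) (μ.prod μ) := by
    simp only [mul_assoc]
    exact (integrable_add_rpow_prod hβ hβ').mul_bdd hχχ hχχ_le
  simp only [← hsq]
  refine ⟨hK.integral_prod_left, ?_⟩
  simp only [intervalIntegral.integral_of_le zero_le_one]
  rw [integral_integral_swap hK, ← hμ, integral_integral
    (f := fun u₁ u₂ => (u₁ + u₂) ^ (1 - (d : ℝ) / α) * χ u₁ * χ u₂) hprod, ← integral_const_mul]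
  refine integral_congr_ae (hmem.mono fun p hp => ?_)
  simp only
  rw [integral_mul_const,
    (integral_one_div_norm_rpow_mul_exp_neg hd hα h1 (add_pos hp.1.1 hp.2.1)).2]
  ring

theorem tendsto_rpow_mul_integral_of_continuous_of_bounded {d : ℕ} {α : ℝ} (hα : 0 < α) {χ : ℝ → ℝ}
    {F : EuclideanSpace ℝ (Fin d) → ℝ} {C : ℝ} (hF : Continuous F) (hC : ∀ z, ‖F z‖ ≤ C)
    (hint : Integrable (fun z : EuclideanSpace ℝ (Fin d) =>
      1 / ‖z‖ ^ α * (∫ u in (0 : ℝ)..1, exp (-(u * ‖z‖ ^ α)) * χ u) ^ 2)) :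
    Tendsto
      (fun T : ℝ => T ^ ((d : ℝ) / α - 1) *
        ∫ z : EuclideanSpace ℝ (Fin d), 1 / ‖z‖ ^ α * F z *
          (∫ u in (0 : ℝ)..1, exp (-(T * u * ‖z‖ ^ α)) * χ u) ^ 2)
      atTop
      (nhds (F 0 * ∫ z : EuclideanSpace ℝ (Fin d),
        1 / ‖z‖ ^ α * (∫ u in (0 : ℝ)..1, exp (-(u * ‖z‖ ^ α)) * χ u) ^ 2)) := by
  set H : EuclideanSpace ℝ (Fin d) → ℝ := fun z =>
    1 / ‖z‖ ^ α * (∫ u in (0 : ℝ)..1, exp (-(u * ‖z‖ ^ α)) * χ u) ^ 2 with hH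
  have hlim : Tendsto (fun T : ℝ => ∫ z, F (T ^ (-α⁻¹) • z) * H z) atTop
      (nhds (∫ z, F 0 * H z)) := by
    refine tendsto_integral_filter_of_dominated_convergence (fun z => C * ‖H z‖)
      (.of_forall fun T => ?_) (.of_forall fun T => .of_forall fun z => ?_)
      (hint.norm.const_mul C) (.of_forall fun z => ?_)
    · exact (hF.comp (continuous_const_smul _)).aestronglyMeasurable.mul hint.aestronglyMeasurable
    · rw [norm_mul]
      gcongr
      exact hC _
    · refine Tendsto.mul_const _ ?_
      have h := (tendsto_rpow_neg_atTop (inv_pos.2 hα)).smul_const z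
      rw [zero_smul] at h
      exact (hF.tendsto 0).comp h
  rw [integral_const_mul] at hlim
  refine hlim.congr' ((eventually_gt_atTop 0).mono fun T hT => ?_)
  have hR : 0 < T ^ (-α⁻¹) := rpow_pos_of_pos hT _
  have hRα : (T ^ (-α⁻¹)) ^ α = T⁻¹ := by
    rw [← rpow_mul hT.le, neg_mul, inv_mul_cancel₀ hα.ne', rpow_neg_one]
  have hRd : ((T ^ (-α⁻¹)) ^ d)⁻¹ = T ^ ((d : ℝ) / α) := by
    rw [← rpow_natCast, ← rpow_mul hT.le, ← rpow_neg hT.le]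
    congr 1
    ring
  have hscale := Measure.integral_comp_smul (volume : Measure (EuclideanSpace ℝ (Fin d)))
    (fun z => 1 / ‖z‖ ^ α * F z *
      (∫ u in (0 : ℝ)..1, exp (-(T * u * ‖z‖ ^ α)) * χ u) ^ 2) (T ^ (-α⁻¹))
  rw [finrank_euclideanSpace_fin, hRd, abs_of_pos (rpow_pos_of_pos hT _), smul_eq_mul] at hscale
  beta_reduce
  rw [rpow_sub_one hT.ne', div_mul_eq_mul_div, ← hscale, eq_div_iff hT.ne', mul_comm _ T,
    ← integral_const_mul]
  congr 1 with z
  have hu : ∀ u : ℝ, T * u * (T⁻¹ * ‖z‖ ^ α) = u * ‖z‖ ^ α := fun u => by field_simp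
  rw [norm_smul, norm_of_nonneg hR.le, mul_rpow hR.le (norm_nonneg z), hRα, hH]
  simp only [hu, one_div, mul_inv, inv_inv]
  ring

/-- Let `α < d < 2α`, let `φ : ℝ^d → ℝ` be a Schwartz function with
Fourier transform `𝓕φ` (normalized so that `𝓕φ(0) = ∫ φ`), let `ψ : [0,1] → ℝ` be
continuous and `χ u = ∫_u^1 ψ(s) ds`.  Then
`lim_{T→∞} T^{d/α − 1} ∫ (1/‖z‖^α) |𝓕φ(z)|² (∫₀¹ e^{-Tu‖z‖^α} χ(u) du)² dz
  = (2 π^{d/2} Γ(d/α − 1) / (α Γ(d/2))) (∫ φ)² ∫₀¹∫₀¹ (u₁+u₂)^{1−d/α} χ(u₁) χ(u₂) du₁ du₂`. -/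
theorem stmt_14
    (d : ℕ) (hd : 0 < d) (α : ℝ) (hα : 0 < α)
    (h1 : α < d) (h2 : (d : ℝ) < 2 * α)
    (φ : SchwartzMap (EuclideanSpace ℝ (Fin d)) ℝ)
    (ψ : ℝ → ℝ) (hψ : ContinuousOn ψ (Set.Icc 0 1))
    (χ : ℝ → ℝ) (hχ : ∀ u, χ u = ∫ s in u..(1 : ℝ), ψ s) :
    Tendsto
      (fun T : ℝ =>
        T ^ ((d : ℝ) / α - 1) *
          ∫ z : EuclideanSpace ℝ (Fin d),
            1 / ‖z‖ ^ α *
              ‖𝓕 (fun y : EuclideanSpace ℝ (Fin d) => (φ y : ℂ)) z‖ ^ 2 *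
              (∫ u in (0 : ℝ)..1, Real.exp (-(T * u * ‖z‖ ^ α)) * χ u) ^ 2)
      atTop
      (nhds
        (2 * Real.pi ^ ((d : ℝ) / 2) * Real.Gamma ((d : ℝ) / α - 1) /
            (α * Real.Gamma ((d : ℝ) / 2)) *
          (∫ x : EuclideanSpace ℝ (Fin d), φ x) ^ 2 *
          ∫ u₁ in (0 : ℝ)..1, ∫ u₂ in (0 : ℝ)..1,
            (u₁ + u₂) ^ (1 - (d : ℝ) / α) * χ u₁ * χ u₂)) := by
  have hcont : ContinuousOn χ (Set.Icc 0 1) := by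
    have h01 : Set.uIcc (0 : ℝ) 1 = Set.Icc 0 1 := Set.uIcc_of_le zero_le_one
    have h := intervalIntegral.continuousOn_primitive_interval_left (μ := volume) (f := ψ)
      (a := 0) (b := 1) (by rw [h01]; exact hψ.integrableOn_Icc)
    rw [h01] at h
    exact h.congr fun u _ => hχ u
  obtain ⟨M, hM⟩ := isCompact_Icc.exists_bound_of_continuousOn hcont
  have hmeas : AEStronglyMeasurable χ (volume.restrict (Set.Ioc 0 1)) :=
    (hcont.mono Set.Ioc_subset_Icc_self).aestronglyMeasurable measurableSet_Ioc
  have hbound : ∀ u ∈ Set.Ioc (0 : ℝ) 1, ‖χ u‖ ≤ M :=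
    fun u hu => hM u (Set.Ioc_subset_Icc_self hu)
  obtain ⟨hint, hval⟩ := integral_one_div_norm_rpow_mul_sq_integral hd hα h1 h2 hmeas hbound
  have hφ : Integrable (fun y : EuclideanSpace ℝ (Fin d) => (φ y : ℂ)) := φ.integrable.ofReal
  have key := tendsto_rpow_mul_integral_of_continuous_of_bounded (d := d) (χ := χ) hα
    (F := fun z => ‖𝓕 (fun y : EuclideanSpace ℝ (Fin d) => (φ y : ℂ)) z‖ ^ 2)
    (C := (∫ y : EuclideanSpace ℝ (Fin d), ‖(φ y : ℂ)‖) ^ 2)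
    ((VectorFourier.fourierIntegral_continuous Real.continuous_fourierChar
      continuous_inner hφ).norm.pow 2)
    (fun z => by
      rw [norm_pow, norm_norm]
      gcongr
      exact VectorFourier.norm_fourierIntegral_le_integral_norm _ _ _ _ _) hint
  have hzero : ‖𝓕 (fun y : EuclideanSpace ℝ (Fin d) => (φ y : ℂ)) 0‖ ^ 2 =
      (∫ x : EuclideanSpace ℝ (Fin d), φ x) ^ 2 := by
    rw [Real.fourier_eq]
    simp [integral_complex_ofReal]
  simp only [hzero, hval] at key
  convert key using 2
  ring
end

section
/- Let φ : ℝ^d → ℝ be a Schwartz function and 𝓕φ its Fourier transform. For 0 < α < d, sup_{z ∈ ℝ^d} ∫_{ℝ^d} |𝓕φ(z − x)| · |𝓕φ(x)| / ‖x‖^α dx < +∞. -/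
open MeasureTheory Real
open scoped FourierTransform

/-- The norm of a Schwartz function times a locally integrable negative power of the norm is
integrable. -/
theorem SchwartzMap.integrable_norm_div_rpow {E F : Type*} [NormedAddCommGroup E]
    [NormedSpace ℝ E] [FiniteDimensional ℝ E] [MeasurableSpace E] [BorelSpace E]
    [NormedAddCommGroup F] [NormedSpace ℝ F] (μ : Measure E) [μ.IsAddHaarMeasure]
    (hE : 1 ≤ Module.finrank ℝ E) {α : ℝ} (hα : 0 ≤ α) (hα' : α < Module.finrank ℝ E)
    (f : SchwartzMap E F) :
    Integrable (fun x => ‖f x‖ / ‖x‖ ^ α) μ := by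
  have hmeas : AEStronglyMeasurable (fun x => ‖f x‖ / ‖x‖ ^ α) μ :=
    (f.continuous.norm.measurable.div (measurable_norm.pow_const α)).aestronglyMeasurable
  have hnonneg (x : E) : 0 ≤ ‖f x‖ / ‖x‖ ^ α := by positivity
  rw [← integrableOn_univ, ← Set.union_compl_self (Metric.ball (0 : E) 1)]
  refine IntegrableOn.union ?_ ?_
  · refine integrableOn_ball_of_norm_le_rpow hE (C := SchwartzMap.seminorm ℝ 0 0 f) hα' ?_ hmeas
    refine Filter.Eventually.of_forall fun x => ?_
    rw [Real.norm_of_nonneg (hnonneg x), Real.rpow_neg (norm_nonneg x), div_eq_mul_inv]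
    gcongr
    exact f.norm_le_seminorm ℝ x
  · refine Integrable.mono' (f.integrable (μ := μ)).norm.integrableOn hmeas.restrict ?_
    refine (ae_restrict_iff' Metric.isOpen_ball.measurableSet.compl).2
      (Filter.Eventually.of_forall fun x hx => ?_)
    have hx1 : 1 ≤ ‖x‖ := by simpa using hx
    rw [Real.norm_of_nonneg (hnonneg x)]
    exact div_le_self (norm_nonneg _) (Real.one_le_rpow hx1 hα)

/-- For `0 < α < d` and a Schwartz function `φ : ℝ^d → ℝ`,
`sup_{z ∈ ℝ^d} ∫ |𝓕φ(z−x)| ⬝ |𝓕φ(x)| / ‖x‖^α dx < +∞`. -/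
theorem stmt_15
    (d : ℕ) (hd : 0 < d) (α : ℝ) (hα : 0 < α) (h1 : α < d)
    (φ : SchwartzMap (EuclideanSpace ℝ (Fin d)) ℝ) :
    ∃ C : ℝ, ∀ z : EuclideanSpace ℝ (Fin d),
      ∫⁻ x : EuclideanSpace ℝ (Fin d),
        ENNReal.ofReal
          (‖𝓕 (fun y : EuclideanSpace ℝ (Fin d) => (φ y : ℂ)) (z - x)‖ *
            ‖𝓕 (fun y : EuclideanSpace ℝ (Fin d) => (φ y : ℂ)) x‖ / ‖x‖ ^ α) ≤
        ENNReal.ofReal C := by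
  obtain ⟨g, hg⟩ : ∃ g : SchwartzMap (EuclideanSpace ℝ (Fin d)) ℂ,
      𝓕 (fun y : EuclideanSpace ℝ (Fin d) => (φ y : ℂ)) = g :=
    ⟨𝓕 (φ.postcompCLM Complex.ofRealCLM),
      (SchwartzMap.fourier_coe (φ.postcompCLM Complex.ofRealCLM)).symm⟩
  rw [hg]
  have hint := (g.integrable_norm_div_rpow volume (by simpa using Nat.succ_le_of_lt hd) hα.le
    (by simpa using h1)).const_mul (SchwartzMap.seminorm ℝ 0 0 g)
  refine ⟨∫ x, SchwartzMap.seminorm ℝ 0 0 g * (‖g x‖ / ‖x‖ ^ α), fun z => ?_⟩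
  rw [ofReal_integral_eq_lintegral_ofReal hint
    (Filter.Eventually.of_forall fun x => by positivity)]
  refine lintegral_mono fun x => ENNReal.ofReal_le_ofReal ?_
  rw [mul_div_assoc]
  gcongr
  exact g.norm_le_seminorm ℝ (z - x)
end
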